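/- arXiv:2305.12360 — 2 statements merged into one kernel-verified Lean document; each statement's English description precedes it below -/
import Mathlib

section
/- Let d ≥ 1, r ≥ 2, and n = (r−1)(d+1). Let A ⊆ ℝ^d be a finite set of points with |A| > n. Then there exist a partition A = A₁ ∪ ⋯ ∪ A_r and a subset B ⊆ A with |B| = n such that for every p ∈ A \ B, ⋂_{i=1}^r conv((B ∪ {p}) ∩ A_i) ≠ ∅. -/
theorem tv_generic {V α : Type*} [AddCommGroup V] [Module ℝ V] (T : Finset α) (v : α → V)
    (F : Finset (Submodule ℝ V)) (hF : ∀ U ∈ F, ∃ t ∈ T, v t ∉ U) :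
    ∃ β : α → ℝ, (∀ t, 0 < β t) ∧ ∀ U ∈ F, ∑ t ∈ T, β t • v t ∉ U := by
  classical
  induction F using Finset.induction_on with
  | empty => exact ⟨fun _ => 1, fun _ => one_pos, by simp⟩
  | insert U F _ ih =>
    obtain ⟨β, hβ, hq⟩ := ih (fun U' h => hF U' (Finset.mem_insert_of_mem h))
    obtain ⟨t0, ht0, hv0⟩ := hF U (Finset.mem_insert_self _ _)
    set q := ∑ t ∈ T, β t • v t with hqdef
    have hsub : ∀ U' ∈ insert U F, {ε : ℝ | q + ε • v t0 ∈ U'}.Subsingleton := by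
      intro U' hU' a ha b hb
      by_contra hab
      simp only [Set.mem_ofPred_eq] at ha hb
      have h1 : (a - b) • v t0 ∈ U' := by
        have := U'.sub_mem ha hb
        rwa [add_sub_add_left_eq_sub, ← sub_smul] at this
      have h2 : v t0 ∈ U' := (U'.smul_mem_iff (sub_ne_zero.2 hab)).1 h1
      rcases Finset.mem_insert.1 hU' with rfl | h
      · exact hv0 h2
      · apply hq U' h
        have := U'.sub_mem ha (U'.smul_mem a h2)
        simpa using this
    have hfin : (⋃ U' ∈ insert U F, {ε : ℝ | q + ε • v t0 ∈ U'}).Finite :=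
      Set.Finite.biUnion (Finset.finite_toSet (insert U F)) (fun U' h => (hsub U' h).finite)
    obtain ⟨ε, hε0, hε⟩ := ((Set.Ioi_infinite (0 : ℝ)).sdiff hfin).nonempty
    refine ⟨fun t => β t + if t = t0 then ε else 0, fun t => ?_, ?_⟩
    · have := hβ t
      have h0 : (0 : ℝ) < ε := hε0
      show 0 < β t + _
      split_ifs <;> linarith
    · intro U' hU' hm
      apply hε
      simp only [Set.mem_iUnion]
      refine ⟨U', hU', ?_⟩
      simpa [add_smul, Finset.sum_add_distrib, ht0, ite_smul] using hm

theorem tv_core {V ι κ : Type*} [AddCommGroup V] [Module ℝ V] [Fintype ι] [Fintype κ] [Nonempty κ]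
    (v : ι × κ → V) (hv : ∀ a, ∑ i, v (a, i) = 0) :
    ∃ T : Finset (ι × κ), Set.InjOn Prod.fst (T : Set (ι × κ)) ∧ LinearIndepOn ℝ v (T : Set (ι × κ)) ∧
      ∀ p, (∀ t ∈ T, t.1 ≠ p) → ∃ i, ∃ β : ι × κ → ℝ, (∀ t, 0 ≤ β t) ∧
        v (p, i) + ∑ t ∈ T, β t • v t = 0 := by
  classical
  -- a maximal independent transversal
  obtain ⟨T0, hT0, hmax⟩ := Set.exists_max_image
    {T : Finset (ι × κ) | Set.InjOn Prod.fst (T : Set (ι × κ)) ∧ LinearIndepOn ℝ v (T : Set (ι × κ))}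
    Finset.card (Set.toFinite _) ⟨∅, by simp [linearIndepOn_empty]⟩
  obtain ⟨hT0i, hT0l⟩ := hT0
  set W := Submodule.span ℝ (v '' (T0 : Set (ι × κ))) with hW
  -- generic vector
  obtain ⟨β0, hβ0, hgen⟩ := tv_generic T0 v
    (((Finset.univ : Finset (Finset (ι × κ))).image
      (fun T' : Finset (ι × κ) => Submodule.span ℝ (v '' (T' : Set (ι × κ))))).filter (fun U => ¬ W ≤ U)) (by
      intro U hU
      by_contra! h
      refine (Finset.mem_filter.1 hU).2 ?_
      rw [hW, Submodule.span_le]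
      rintro _ ⟨t, ht, rfl⟩
      exact h t ht)
  set q := ∑ t ∈ T0, β0 t • v t with hq
  have hgen' : ∀ T' : Finset (ι × κ), q ∈ Submodule.span ℝ (v '' (T' : Set (ι × κ))) →
      W ≤ Submodule.span ℝ (v '' (T' : Set (ι × κ))) := by
    intro T' h
    by_contra hn
    exact hgen _ (Finset.mem_filter.2 ⟨Finset.mem_image_of_mem _ (Finset.mem_univ _), hn⟩) h
  -- feasible transversals
  let S : Set (Finset (ι × κ)) := {T | Set.InjOn Prod.fst (T : Set (ι × κ)) ∧
    LinearIndepOn ℝ v (T : Set (ι × κ)) ∧ T.card = T0.card ∧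
    Submodule.span ℝ (v '' (T : Set (ι × κ))) = W ∧
    ∃ β : ι × κ → ℝ, (∀ t ∈ T, 0 < β t) ∧ ∑ t ∈ T, β t • v t = q}
  have hS : ∀ T, ∃ β : ι × κ → ℝ, T ∈ S → (∀ t ∈ T, 0 < β t) ∧ ∑ t ∈ T, β t • v t = q := by
    intro T
    by_cases h : T ∈ S
    · obtain ⟨β, hβ⟩ := h.2.2.2.2
      exact ⟨β, fun _ => hβ⟩
    · exact ⟨0, fun h' => absurd h' h⟩
  choose β hβ using hS
  obtain ⟨T, hTS, hTmax⟩ := Set.exists_max_image S (fun T => ∑ t ∈ T, β T t) (Set.toFinite _)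
    ⟨T0, hT0i, hT0l, rfl, rfl, β0, fun t _ => hβ0 t, rfl⟩
  obtain ⟨hβpos, hβsum⟩ := hβ T hTS
  obtain ⟨hTi, hTl, hTc, hTW, -⟩ := id hTS
  refine ⟨T, hTi, hTl, fun p hp => ?_⟩
  have hpT : ∀ i, (p, i) ∉ T := fun i h => hp _ h rfl
  have hinj : ∀ T' ⊆ T, ∀ i, Set.InjOn Prod.fst ((insert (p, i) T' : Finset (ι × κ)) : Set (ι × κ)) := by
    intro T' hT' i
    rw [Finset.coe_insert, Set.injOn_insert (fun h => hpT i (hT' h))]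
    refine ⟨hTi.mono (by exact_mod_cast hT'), ?_⟩
    rintro ⟨t, ht, hte⟩
    exact hp t (hT' ht) hte
  have hmem : ∀ i, v (p, i) ∈ Submodule.span ℝ (v '' (T : Set (ι × κ))) := by
    intro i
    by_contra hn
    have := hmax (insert (p, i) T) ⟨hinj T subset_rfl i, by
      rw [Finset.coe_insert]; exact hTl.insert hn⟩
    rw [Finset.card_insert_of_notMem (hpT i)] at this
    omega
  have hex : ∀ i, ∃ δ : ι × κ → ℝ, ∑ t ∈ T, δ t • v t = v (p, i) := fun i =>
    (Submodule.mem_span_image_finset_iff_exists_fun' ℝ).1 (hmem i)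
  choose δ hδ using hex
  have hδ0 : ∀ t ∈ T, ∑ i, δ i t = 0 := by
    refine linearIndepOn_finset_iff.1 hTl (fun t => ∑ i, δ i t) ?_
    simp_rw [Finset.sum_smul]
    rw [Finset.sum_comm]
    simp_rw [hδ]
    exact hv p
  obtain ⟨i, hi⟩ : ∃ i, ∑ t ∈ T, δ i t < 1 := by
    by_contra! h
    have h1 : ∑ i : κ, (1 : ℝ) ≤ ∑ i, ∑ t ∈ T, δ i t := Finset.sum_le_sum (fun i _ => h i)
    rw [Finset.sum_comm, Finset.sum_eq_zero hδ0] at h1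
    have : 0 < Fintype.card κ := Fintype.card_pos
    simp at h1
  have hneg : ∀ t ∈ T, δ i t ≤ 0 := by
    by_contra! hcon
    obtain ⟨t1, ht1, ht1p⟩ := hcon
    obtain ⟨s, hs, hsmin⟩ := Finset.exists_min_image (T.filter (fun t => 0 < δ i t))
      (fun t => β T t / δ i t) ⟨t1, by simp [ht1, ht1p]⟩
    obtain ⟨hsT, hsp⟩ := Finset.mem_filter.1 hs
    obtain ⟨θ, hθ⟩ : ∃ θ, θ = β T s / δ i s := ⟨_, rfl⟩
    have hθp : 0 < θ := hθ ▸ div_pos (hβpos s hsT) hsp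
    have hnn : ∀ t ∈ T, 0 ≤ β T t - θ * δ i t := by
      intro t ht
      by_cases h : 0 < δ i t
      · have := hsmin t (by simp [ht, h])
        rw [← hθ, le_div_iff₀ h] at this
        linarith
      · have := hβpos t ht
        nlinarith
    have hs0 : β T s - θ * δ i s = 0 := by rw [hθ]; field_simp; try ring
    set T' := insert (p, i) (T.erase s) with hT'
    have hpe : (p, i) ∉ T.erase s := fun h => hpT i (Finset.mem_of_mem_erase h)
    let β' : ι × κ → ℝ := fun t => if t = (p, i) then θ else β T t - θ * δ i t
    have hβ'p : β' (p, i) = θ := by simp [β']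
    have hβ'e : ∀ t ∈ T.erase s, β' t = β T t - θ * δ i t := by
      intro t ht
      have : t ≠ (p, i) := fun h => hpe (h ▸ ht)
      simp [β', this]
    have hβ'sum : ∑ t ∈ T', β' t • v t = q := by
      rw [hT', Finset.sum_insert hpe, hβ'p,
        Finset.sum_congr rfl (fun t ht => by rw [hβ'e t ht])]
      have h1 : ∑ t ∈ T.erase s, (β T t - θ * δ i t) • v t = ∑ t ∈ T, (β T t - θ * δ i t) • v t := by
        rw [← Finset.add_sum_erase T _ hsT, hs0, zero_smul, zero_add]
      rw [h1]
      simp_rw [sub_smul, mul_smul]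
      rw [Finset.sum_sub_distrib, ← Finset.smul_sum, hδ, hβsum]
      abel
    have hβ'Z : ∑ t ∈ T, β T t < ∑ t ∈ T', β' t := by
      rw [hT', Finset.sum_insert hpe, hβ'p, Finset.sum_congr rfl hβ'e]
      have h1 : ∑ t ∈ T.erase s, (β T t - θ * δ i t) = ∑ t ∈ T, (β T t - θ * δ i t) := by
        rw [← Finset.add_sum_erase T _ hsT, hs0, zero_add]
      rw [h1, Finset.sum_sub_distrib, ← Finset.mul_sum]
      nlinarith
    have hlin : LinearIndepOn ℝ v (T' : Set (ι × κ)) := by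
      rw [hT', Finset.coe_insert]
      refine (hTl.mono (by exact_mod_cast Finset.erase_subset s T)).insert ?_
      intro h
      obtain ⟨c, hc⟩ := (Submodule.mem_span_image_finset_iff_exists_fun' ℝ).1 h
      have := linearIndepOn_finset_iffₛ.1 hTl (fun t => if t = s then 0 else c t) (δ i) (by
        rw [hδ, ← hc, ← Finset.add_sum_erase T _ hsT]
        simp only [if_true, zero_smul, zero_add]
        refine Finset.sum_congr rfl fun t ht => ?_
        rw [if_neg (Finset.ne_of_mem_erase ht)]) s hsT
      simp at this
      linarith
    have hspan_le : Submodule.span ℝ (v '' (T' : Set (ι × κ))) ≤ W := by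
      rw [Submodule.span_le, ← hTW]
      rintro _ ⟨t, ht, rfl⟩
      rcases Finset.mem_insert.1 (Finset.mem_coe.1 ht) with rfl | h
      · exact hmem i
      · exact Submodule.subset_span ⟨t, Finset.mem_of_mem_erase h, rfl⟩
    have hspan : Submodule.span ℝ (v '' (T' : Set (ι × κ))) = W := by
      refine le_antisymm hspan_le (hgen' T' ?_)
      exact (Submodule.mem_span_image_finset_iff_exists_fun' ℝ).2 ⟨β', hβ'sum⟩
    have hβ'pos : ∀ t ∈ T', 0 < β' t := by
      intro t ht
      have h0 : 0 ≤ β' t := by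
        rcases Finset.mem_insert.1 ht with rfl | h
        · simp [β', hθp.le]
        · have : t ≠ (p, i) := fun h' => hpe (h' ▸ h)
          simpa [β', this] using hnn t (Finset.mem_of_mem_erase h)
      refine lt_of_le_of_ne h0 fun h0' => ?_
      have h2 := hgen' (T'.erase t) (by
        refine (Submodule.mem_span_image_finset_iff_exists_fun' ℝ).2 ⟨β', ?_⟩
        rw [← hβ'sum, ← Finset.add_sum_erase T' _ ht, ← h0', zero_smul, zero_add])
      have h3 : v t ∈ Submodule.span ℝ (v '' ((T'.erase t : Finset (ι × κ)) : Set (ι × κ))) :=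
        h2 (hspan ▸ Submodule.subset_span ⟨t, ht, rfl⟩)
      have h4 : LinearIndepOn ℝ v (insert t ((T'.erase t : Finset (ι × κ)) : Set (ι × κ))) := by
        rw [← Finset.coe_insert, Finset.insert_erase ht]; exact hlin
      exact ((linearIndepOn_insert (by simp)).1 h4).2 h3
    have hT'S : T' ∈ S := by
      refine ⟨hinj _ (Finset.erase_subset _ _) i, hlin, ?_, hspan, β', hβ'pos, hβ'sum⟩
      rw [hT', Finset.card_insert_of_notMem hpe, Finset.card_erase_of_mem hsT, ← hTc]
      have := Finset.card_pos.2 ⟨s, hsT⟩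
      omega
    have huniq := linearIndepOn_finset_iffₛ.1 hlin (β T') β' (by rw [(hβ T' hT'S).2, hβ'sum])
    have := hTmax T' hT'S
    rw [Finset.sum_congr rfl huniq] at this
    linarith
  refine ⟨i, fun t => if t ∈ T then - δ i t else 0, fun t => ?_, ?_⟩
  · show 0 ≤ if t ∈ T then - δ i t else 0
    split_ifs with h
    · linarith [hneg t h]
    · exact le_rfl
  · have : ∑ t ∈ T, (if t ∈ T then - δ i t else 0) • v t = - ∑ t ∈ T, δ i t • v t := by
      rw [← Finset.sum_neg_distrib]
      refine Finset.sum_congr rfl fun t ht => ?_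
      rw [if_pos ht, neg_smul]
    rw [this, hδ, add_neg_cancel]

theorem tv_core2 {E V κ : Type*} [AddCommGroup V] [Module ℝ V] [Fintype κ] [Nonempty κ]
    (A : Finset E) (v : E → κ → V) (hv : ∀ a, ∑ i, v a i = 0) :
    ∃ (c : E → κ) (B : Finset E), B ⊆ A ∧ LinearIndepOn ℝ (fun x => v x (c x)) (B : Set E) ∧
      ∀ p ∈ A, p ∉ B → ∃ w : E → ℝ, (∀ x, 0 ≤ w x) ∧
        v p (c p) + ∑ x ∈ B, w x • v x (c x) = 0 := by
  classical
  obtain ⟨T, hTi, hTl, hT⟩ := tv_core (ι := A) (κ := κ) (fun t => v t.1 t.2) (fun a => hv a)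
  have hc : ∀ x : E, ∃ i : κ, (∀ t ∈ T, (t.1 : E) = x → t.2 = i) ∧
      (x ∈ A → (∀ t ∈ T, (t.1 : E) ≠ x) → ∃ β : A × κ → ℝ, (∀ t, 0 ≤ β t) ∧
        v x i + ∑ t ∈ T, β t • v t.1 t.2 = 0) := by
    intro x
    by_cases h : ∃ t ∈ T, (t.1 : E) = x
    · obtain ⟨t, ht, rfl⟩ := h
      refine ⟨t.2, fun t' ht' he => ?_, fun _ h => absurd rfl (h t ht)⟩
      rw [hTi ht' ht (Subtype.ext he)]
    · push Not at h
      by_cases hx : x ∈ A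
      · obtain ⟨i, β, h1, h2⟩ := hT ⟨x, hx⟩ (fun t ht he => h t ht (by rw [he]))
        exact ⟨i, fun t ht he => absurd he (h t ht), fun _ _ => ⟨β, h1, h2⟩⟩
      · exact ⟨Classical.arbitrary κ, fun t ht he => absurd he (h t ht), fun h' => absurd h' hx⟩
  choose c hc1 hc2 using hc
  have hfi : Set.InjOn (fun t : A × κ => (t.1 : E)) (T : Set (A × κ)) :=
    fun t ht t' ht' h => hTi ht ht' (Subtype.ext h)
  refine ⟨c, T.image (fun t => (t.1 : E)), ?_, ?_, ?_⟩
  · intro x hx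
    obtain ⟨t, _, rfl⟩ := Finset.mem_image.1 hx
    exact t.1.2
  · rw [linearIndepOn_finset_iff]
    intro f hf x hx
    obtain ⟨t, ht, rfl⟩ := Finset.mem_image.1 hx
    rw [Finset.sum_image hfi] at hf
    refine linearIndepOn_finset_iff.1 hTl (fun t => f t.1) ?_ t ht
    rw [← hf]
    refine Finset.sum_congr rfl fun t ht => ?_
    rw [← hc1 _ t ht rfl]
  · intro p hp hpB
    obtain ⟨β, h1, h2⟩ := hc2 p hp (fun t ht he => hpB (Finset.mem_image.2 ⟨t, ht, he⟩))
    refine ⟨fun x => if h : x ∈ A then β (⟨x, h⟩, c x) else 0, fun x => ?_, ?_⟩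
    · show 0 ≤ dite _ _ _
      split_ifs
      · exact h1 _
      · exact le_rfl
    · rw [Finset.sum_image hfi, ← h2]
      congr 1
      refine Finset.sum_congr rfl fun t ht => ?_
      have he := hc1 _ t ht rfl
      simp [← he]

/-- Sarkaria's lifting. -/
noncomputable def tvLift (d s : ℕ) (x : Fin d → ℝ) (i : Fin (s + 1)) : Fin s → (Fin d → ℝ) × ℝ :=
  fun j => (if i = j.castSucc then (1 : ℝ) else 0) • (x, (1 : ℝ)) -
    (if i = Fin.last s then (1 : ℝ) else 0) • (x, (1 : ℝ))

theorem tv_geom (d s : ℕ) (c : (Fin d → ℝ) → Fin (s + 1)) (S : Finset (Fin d → ℝ))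
    (w : (Fin d → ℝ) → ℝ) (hw : ∀ x, 0 ≤ w x) (p : Fin d → ℝ) (hp : p ∈ S) (hwp : 0 < w p)
    (h : ∑ x ∈ S, w x • tvLift d s x (c x) = 0) :
    (⋂ i : Fin (s + 1),
      convexHull ℝ (↑(S.filter (fun x => c x = i)) : Set (Fin d → ℝ))).Nonempty := by
  classical
  have hG : ∀ i, ∑ x ∈ S.filter (fun x => c x = i), w x • (x, (1 : ℝ)) =
      ∑ x ∈ S.filter (fun x => c x = Fin.last s), w x • (x, (1 : ℝ)) := by
    intro i
    refine Fin.lastCases rfl (fun j => ?_) i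
    have hj := congrFun h j
    rw [Finset.sum_apply] at hj
    simp only [tvLift, Pi.smul_apply, Pi.zero_apply, smul_sub, Finset.sum_sub_distrib] at hj
    rw [sub_eq_zero] at hj
    rw [Finset.sum_filter, Finset.sum_filter]
    convert hj using 2 with x _ x _
    · split_ifs <;> simp
    · split_ifs <;> simp
  have h1 : ∀ i, ∑ x ∈ S.filter (fun x => c x = i), w x • x =
      ∑ x ∈ S.filter (fun x => c x = Fin.last s), w x • x := by
    intro i
    have := congrArg Prod.fst (hG i)
    simpa [Prod.fst_sum] using this
  have h2 : ∀ i, ∑ x ∈ S.filter (fun x => c x = i), w x =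
      ∑ x ∈ S.filter (fun x => c x = Fin.last s), w x := by
    intro i
    have := congrArg Prod.snd (hG i)
    simpa [Prod.snd_sum] using this
  have hpos : ∀ i, 0 < ∑ x ∈ S.filter (fun x => c x = i), w x := by
    intro i
    rw [h2 i, ← h2 (c p)]
    exact Finset.sum_pos' (fun x _ => hw x) ⟨p, by simp [hp], hwp⟩
  refine ⟨(S.filter (fun x => c x = Fin.last s)).centerMass w id, Set.mem_iInter.2 fun i => ?_⟩
  have : (S.filter (fun x => c x = Fin.last s)).centerMass w id =
      (S.filter (fun x => c x = i)).centerMass w id := by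
    simp only [Finset.centerMass, id, h1 i, h2 i]
  rw [this]
  exact Finset.centerMass_mem_convexHull _ (fun x _ => hw x) (hpos i) (fun x hx => hx)

/-- Tverberg partitions with a Tverberg center: any set of more than `(r-1)(d+1)` points
in `ℝ^d` has a partition into `r` parts, together with a subset `B` of size `(r-1)(d+1)`,
such that for every `p ∉ B` the induced partition of `B ∪ {p}` is a Tverberg partition. -/
theorem stmt_17 (d r : ℕ) (hd : 1 ≤ d) (hr : 2 ≤ r)
    (A : Finset (Fin d → ℝ)) (hA : (r - 1) * (d + 1) < A.card) :
    ∃ (c : (Fin d → ℝ) → Fin r) (B : Finset (Fin d → ℝ)),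
      B ⊆ A ∧ B.card = (r - 1) * (d + 1) ∧
      ∀ p ∈ A \ B,
        (⋂ i : Fin r,
          convexHull ℝ (↑((insert p B).filter (fun x => c x = i)) : Set (Fin d → ℝ))).Nonempty := by
  obtain ⟨s, rfl⟩ : ∃ s, r = s + 1 := ⟨r - 1, by omega⟩
  rw [Nat.add_sub_cancel] at hA ⊢
  obtain ⟨c, B0, hB0A, hlin, hB0⟩ := tv_core2 A (tvLift d s) (by
    intro a
    funext j
    rw [Finset.sum_apply]
    simp [tvLift, Finset.sum_sub_distrib])
  have hcard : B0.card ≤ s * (d + 1) := by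
    have := hlin.fintype_card_le_finrank
    simpa [Module.finrank_pi_fintype, Module.finrank_prod] using this
  obtain ⟨B, hB0B, hBA, hBc⟩ := Finset.exists_subsuperset_card_eq hB0A hcard hA.le
  refine ⟨c, B, hBA, hBc, fun p hp => ?_⟩
  obtain ⟨hpA, hpB⟩ := Finset.mem_sdiff.1 hp
  obtain ⟨w, hw, hsum⟩ := hB0 p hpA (fun h => hpB (hB0B h))
  refine tv_geom d s c (insert p B) (fun x => if x = p then 1 else if x ∈ B0 then w x else 0)
    (fun x => ?_) p (Finset.mem_insert_self _ _) (by simp) ?_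
  · show 0 ≤ ite _ _ _
    split_ifs
    · exact zero_le_one
    · exact hw x
    · exact le_rfl
  · rw [Finset.sum_insert hpB, ← hsum]
    congr 1
    · simp
    · rw [← Finset.sum_subset hB0B]
      · refine Finset.sum_congr rfl fun x hx => ?_
        have : x ≠ p := fun h => hpB (h ▸ hB0B hx)
        simp [this, hx]
      · intro x hx hx0
        have : x ≠ p := fun h => hpB (h ▸ hx)
        simp [this, hx0]
end

section
/- Let d ≥ 1, r ≥ 2, and t ≥ 0. Let A ⊆ ℝ^d be a finite set of points with |A| ≥ (t+1)(r−1)(d+1) + 1. Then there exists a partition A = A₁ ∪ ⋯ ∪ A_r such that for every subset C ⊆ A with |C| ≤ t, ⋂_{i=1}^r conv(A_i \ C) ≠ ∅. -/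
/-- First-order optimality of the nearest point of a convex set to the origin. -/
lemma near_inner {E : Type*} [NormedAddCommGroup E] [InnerProductSpace ℝ E] {K : Set E}
    (hK : Convex ℝ K) {q : E} (hq : q ∈ K) (h : ∀ y ∈ K, ‖q‖ ≤ ‖y‖) {x : E} (hx : x ∈ K) :
    ‖q‖ ^ 2 ≤ inner ℝ q x := by
  have hne : Nonempty K := ⟨⟨q, hq⟩⟩
  have h1 : ‖(0 : E) - q‖ = ⨅ w : K, ‖(0 : E) - w‖ := by
    apply le_antisymm
    · apply le_ciInf
      intro w
      simpa using h w w.2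
    · have hb : BddBelow (Set.range fun w : K => ‖(0 : E) - w‖) :=
        ⟨0, by rintro _ ⟨w, rfl⟩; exact norm_nonneg _⟩
      exact ciInf_le hb ⟨q, hq⟩
  have h2 := (norm_eq_iInf_iff_real_inner_le_zero hK hq).1 h1 x hx
  rw [zero_sub, inner_neg_left, inner_sub_right, real_inner_self_eq_norm_sq] at h2
  linarith

/-- The nearest point lies in the hull of at most `finrank W` points of the family. -/
lemma small_support {E : Type*} [NormedAddCommGroup E] [InnerProductSpace ℝ E]
    {ι : Type*} [DecidableEq ι] (W : Submodule ℝ E) [FiniteDimensional ℝ W]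
    (Y : ι → E) (hYW : ∀ i, Y i ∈ W) (B : Finset ι) {q : E} (hq0 : q ≠ 0)
    (hq : q ∈ convexHull ℝ (Y '' (B : Set ι)))
    (hmin : ∀ y ∈ convexHull ℝ (Y '' (B : Set ι)), ‖q‖ ≤ ‖y‖) :
    ∃ F ⊆ B, F.card ≤ Module.finrank ℝ W ∧ q ∈ convexHull ℝ (Y '' (F : Set ι)) := by
  obtain ⟨κ, _, z, w, hz, haff, hw, hw1, hwz⟩ := eq_pos_convex_span_of_mem_convexHull hq
  have hge : ∀ k, ‖q‖ ^ 2 ≤ inner ℝ q (z k) := fun k =>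
    near_inner (convex_convexHull ℝ _) hq hmin (subset_convexHull ℝ _ (hz ⟨k, rfl⟩))
  have hsum : ∑ k, w k * (inner ℝ q (z k) - ‖q‖ ^ 2) = 0 := by
    have : inner ℝ q (∑ k, w k • z k) = ‖q‖ ^ 2 := by rw [hwz, real_inner_self_eq_norm_sq]
    rw [inner_sum] at this
    simp only [inner_smul_right] at this
    simp only [mul_sub, Finset.sum_sub_distrib, ← Finset.sum_mul, hw1, this]
    ring
  have heq : ∀ k, inner ℝ q (z k) = ‖q‖ ^ 2 := by
    intro k
    have := (Finset.sum_eq_zero_iff_of_nonneg (fun k _ =>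
      mul_nonneg (hw k).le (sub_nonneg.2 (hge k)))).1 hsum k (Finset.mem_univ _)
    rcases mul_eq_zero.1 this with h | h
    · exact absurd h (hw k).ne'
    · linarith
  have hzY : ∀ k, ∃ i ∈ B, Y i = z k := by
    intro k
    obtain ⟨i, hi, h⟩ := hz ⟨k, rfl⟩
    exact ⟨i, hi, h⟩
  choose f hfB hf using hzY
  have hzW : ∀ k, z k ∈ W := fun k => hf k ▸ hYW _
  have hqW : q ∈ W := by
    rw [← hwz]
    exact Submodule.sum_mem _ fun k _ => Submodule.smul_mem _ _ (hzW k)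
  have hlt : vectorSpan ℝ (Set.range z) < W := by
    refine lt_of_le_of_ne ?_ ?_
    · rw [vectorSpan_def, Submodule.span_le]
      rintro _ ⟨_, ⟨a, rfl⟩, _, ⟨b, rfl⟩, rfl⟩
      exact W.sub_mem (hzW a) (hzW b)
    · intro h
      have hle : vectorSpan ℝ (Set.range z) ≤ LinearMap.ker (innerₛₗ ℝ q) := by
        rw [vectorSpan_def, Submodule.span_le]
        rintro _ ⟨_, ⟨a, rfl⟩, _, ⟨b, rfl⟩, rfl⟩
        simp [inner_sub_right, heq]
      have := hle (h ▸ hqW)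
      simp at this
      exact hq0 this
  have hcard : Fintype.card κ ≤ Module.finrank ℝ W :=
    haff.card_le_finrank_succ.trans (Submodule.finrank_lt_finrank_of_lt hlt)
  refine ⟨Finset.univ.image f, ?_, Finset.card_image_le.trans (by simpa using hcard), ?_⟩
  · intro i hi
    obtain ⟨k, _, rfl⟩ := Finset.mem_image.1 hi
    exact hfB k
  · refine mem_convexHull_of_exists_fintype w z (fun k => (hw k).le) hw1 (fun k => ?_) hwz
    exact ⟨f k, by simp, hf k⟩

/-- Colourful Carathéodory theorem with tolerance, for families with a group action. -/
lemma tolerance_key {E : Type*} [NormedAddCommGroup E] [InnerProductSpace ℝ E]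
    {ι : Type*} [DecidableEq ι] [Fintype ι] {G : Type*} [AddGroup G] [Fintype G]
    (W : Submodule ℝ E) [FiniteDimensional ℝ W]
    (X : ι → G → E) (hXW : ∀ i g, X i g ∈ W) (hsum : ∀ i, ∑ g, X i g = 0)
    (T : G → E →ₗ[ℝ] E) (hT : ∀ g i h, T g (X i h) = X i (h + g))
    (hG : Fintype.card G ≤ Module.finrank ℝ W) (k : ℕ) :
    ∀ S : Finset ι, Module.finrank ℝ W * k + 1 ≤ S.card →
      ∃ c : ι → G, ∀ C ⊆ S, C.card < k →
        (0 : E) ∈ convexHull ℝ ((fun i => X i (c i)) '' ((S \ C : Finset ι) : Set ι)) := by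
  induction k with
  | zero => exact fun S _ => ⟨fun _ => 0, fun C _ h => absurd h (by simp)⟩
  | succ k ih =>
    intro S hS
    have hGpos : 1 ≤ Fintype.card G := Fintype.card_pos
    have hkS : k + 1 < S.card := by nlinarith
    classical
    set D : (ι → G) → Finset ι → ℝ := fun c C =>
      Metric.infDist (0 : E) (convexHull ℝ ((fun i => X i (c i)) '' ((S \ C : Finset ι) : Set ι)))
      with hD
    set P : Finset (Finset ι) := S.powerset.filter (fun C => C.card ≤ k) with hP
    have hPne : P.Nonempty := ⟨∅, by simp [hP]⟩
    have hne : ∀ (c : ι → G), ∀ C ∈ P, (convexHull ℝ ((fun i => X i (c i)) ''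
        ((S \ C : Finset ι) : Set ι))).Nonempty := by
      intro c C hC
      simp only [hP, Finset.mem_filter, Finset.mem_powerset] at hC
      have h1 : 0 < (S \ C).card := by
        have := Finset.le_card_sdiff C S
        omega
      rw [convexHull_nonempty_iff]
      exact (Finset.card_pos.1 h1).to_set.image _
    have hcpt : ∀ (c : ι → G) (C : Finset ι), IsCompact (convexHull ℝ ((fun i => X i (c i)) ''
        ((S \ C : Finset ι) : Set ι))) := fun c C =>
      ((Finset.finite_toSet _).image _).isCompact_convexHull ℝ
    obtain ⟨c, hc⟩ := Finite.exists_min (fun c => P.sup' hPne (D c))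
    by_contra hcon
    push Not at hcon
    obtain ⟨C₀, hC₀S, hC₀k, hC₀⟩ := hcon c
    have hC₀P : C₀ ∈ P := by
      simp only [hP, Finset.mem_filter, Finset.mem_powerset]
      exact ⟨hC₀S, by omega⟩
    obtain ⟨C, hCP, hCD⟩ := Finset.exists_mem_eq_sup' hPne (D c)
    have hpos : 0 < D c C := by
      have h1 : D c C₀ ≤ D c C := hCD ▸ Finset.le_sup' (D c) hC₀P
      refine lt_of_lt_of_le ?_ h1
      refine lt_of_le_of_ne Metric.infDist_nonneg fun h => hC₀ ?_
      exact ((hcpt c C₀).isClosed.mem_iff_infDist_zero (hne c C₀ hC₀P)).2 h.symm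
    obtain ⟨q, hqK, hqd⟩ := (hcpt c C).exists_infDist_eq_dist (hne c C hCP) 0
    have hqn : D c C = ‖q‖ := by rw [hD]; simpa using hqd
    have hq0 : q ≠ 0 := by
      rintro rfl
      simp [hqn] at hpos
    have hmin : ∀ y ∈ convexHull ℝ ((fun i => X i (c i)) '' ((S \ C : Finset ι) : Set ι)),
        ‖q‖ ≤ ‖y‖ := by
      intro y hy
      rw [← hqn]
      have h := Metric.infDist_le_dist_of_mem (x := (0 : E)) hy
      rw [dist_zero_left] at h
      exact h
    obtain ⟨F, hFS, hFc, hqF⟩ := small_support W (fun i => X i (c i)) (fun i => hXW _ _) (S \ C)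
      hq0 hqK hmin
    have hFS' : F ⊆ S := hFS.trans Finset.sdiff_subset
    have hSF : Module.finrank ℝ W * k + 1 ≤ (S \ F).card := by
      have := Finset.le_card_sdiff F S
      rw [mul_add] at hS
      omega
    obtain ⟨c₀, hc₀⟩ := ih (S \ F) hSF
    set c' : G → ι → G := fun g i => if i ∈ F then c i else c₀ i + g with hc'
    have hbad : ∀ g, ∃ C' ∈ P, ‖q‖ ≤ D (c' g) C' := by
      intro g
      obtain ⟨C', hC', h⟩ := Finset.exists_mem_eq_sup' hPne (D (c' g))
      refine ⟨C', hC', ?_⟩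
      rw [← h, ← hqn, ← hCD]
      exact hc (c' g)
    choose Cg hCgP hCgD using hbad
    have hCgk : ∀ g, (Cg g).card ≤ k := fun g => (Finset.mem_filter.1 (hCgP g)).2
    have hCgS : ∀ g, Cg g ⊆ S := fun g => Finset.mem_powerset.1 (Finset.mem_filter.1 (hCgP g)).1
    have hdisj : ∀ g, ∀ i ∈ F, i ∉ Cg g := by
      intro g i hiF hiC
      have hlt : (Cg g \ F).card < k := by
        refine lt_of_lt_of_le (Finset.card_lt_card ?_) (hCgk g)
        refine Finset.ssubset_iff_subset_ne.2 ⟨Finset.sdiff_subset, fun h => ?_⟩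
        rw [← h] at hiC
        exact (Finset.mem_sdiff.1 hiC).2 hiF
      have h0 := hc₀ (Cg g \ F) (Finset.sdiff_subset_sdiff (hCgS g) le_rfl) hlt
      have h1 : (0 : E) ∈ convexHull ℝ ((fun i => X i (c' g i)) ''
          ((S \ Cg g : Finset ι) : Set ι)) := by
        have h2 := Set.mem_image_of_mem (T g) h0
        rw [map_zero, LinearMap.image_convexHull] at h2
        refine convexHull_mono ?_ h2
        rintro _ ⟨_, ⟨j, hj, rfl⟩, rfl⟩
        simp only [Finset.coe_sdiff, Set.mem_sdiff, Finset.mem_coe] at hj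
        refine ⟨j, ?_, ?_⟩
        · simp only [Finset.coe_sdiff, Set.mem_sdiff, Finset.mem_coe]
          tauto
        · simp only [hc', if_neg hj.1.2, hT]
      have h3 : D (c' g) (Cg g) = 0 := Metric.infDist_zero_of_mem h1
      have := hCgD g
      rw [h3, ← hqn] at this
      linarith
    have hinner : ∀ g, ∀ i ∈ S, i ∉ Cg g → 0 < inner ℝ q (X i (c' g i)) := by
      intro g i hi hiC
      refine lt_of_lt_of_le (by positivity : 0 < ‖q‖ ^ 2) ?_
      refine near_inner (K := convexHull ℝ ((fun i => X i (c' g i)) ''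
          ((S \ Cg g : Finset ι) : Set ι))) (convex_convexHull ℝ _) ?_ ?_ ?_
      · refine convexHull_mono ?_ hqF
        rintro _ ⟨j, hj, rfl⟩
        have hj' : j ∈ F := hj
        refine ⟨j, ?_, ?_⟩
        · simp only [Finset.coe_sdiff, Set.mem_sdiff, Finset.mem_coe]
          exact ⟨hFS' hj', hdisj g j hj'⟩
        · simp only [hc', if_pos hj']
      · intro y hy
        refine (hCgD g).trans ?_
        have h := Metric.infDist_le_dist_of_mem (x := (0 : E)) hy
        rw [dist_zero_left] at h
        exact h
      · exact subset_convexHull ℝ _ ⟨i, by simp [hi, hiC], rfl⟩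
    have hex : ∃ i ∈ S \ F, i ∉ Finset.univ.biUnion Cg := by
      apply Finset.exists_mem_notMem_of_card_lt_card
      have h1 := Finset.card_biUnion_le_card_mul Finset.univ Cg k (fun g _ => hCgk g)
      rw [Finset.card_univ] at h1
      have := Nat.mul_le_mul_right k hG
      omega
    obtain ⟨i, hi, hiC⟩ := hex
    simp only [Finset.mem_biUnion, Finset.mem_univ, true_and, not_exists] at hiC
    rw [Finset.mem_sdiff] at hi
    have hs : 0 < ∑ g, inner ℝ q (X i (c₀ i + g)) := by
      refine Finset.sum_pos (fun g _ => ?_) Finset.univ_nonempty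
      have := hinner g i hi.1 (hiC g)
      simpa only [hc', if_neg hi.2] using this
    have hre : ∑ g, X i (c₀ i + g) = ∑ g, X i g :=
      Fintype.sum_equiv (Equiv.addLeft (c₀ i)) _ (X i) (fun g => rfl)
    rw [← inner_sum, hre, hsum,
      inner_zero_right] at hs
    exact lt_irrefl _ hs

/-- Summation over the colour coordinate. -/
noncomputable def colourSum (G M : Type) [Fintype G] [Fintype M] :
    EuclideanSpace ℝ (G × M) →ₗ[ℝ] (M → ℝ) where
  toFun x m := ∑ g, x (g, m)
  map_add' x y := by ext m; simp [Finset.sum_add_distrib]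
  map_smul' a x := by ext m; simp [Finset.mul_sum]

/-- Translation of the colour coordinate. -/
noncomputable def colourShift (G M : Type) [AddGroup G] [Fintype G] [Fintype M] (g : G) :
    EuclideanSpace ℝ (G × M) →ₗ[ℝ] EuclideanSpace ℝ (G × M) where
  toFun x := WithLp.toLp 2 fun p => x (p.1 - g, p.2)
  map_add' x y := by ext m; simp
  map_smul' a x := by ext m; simp

lemma finrank_ker_colourSum (G M : Type) [Fintype G] [Fintype M] [Nonempty G] :
    Module.finrank ℝ (LinearMap.ker (colourSum G M)) + Fintype.card M =
      Fintype.card G * Fintype.card M := by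
  classical
  have hsurj : Function.Surjective (colourSum G M) := by
    intro y
    obtain ⟨g₀⟩ := ‹Nonempty G›
    refine ⟨WithLp.toLp 2 fun p => if p.1 = g₀ then y p.2 else 0, ?_⟩
    ext m
    simp [colourSum]
  have h := LinearMap.finrank_range_add_finrank_ker (colourSum G M)
  rw [LinearMap.range_eq_top.2 hsurj, finrank_top] at h
  simp at h
  omega

/-- (Soberón–Strausz) Any set of at least `(t+1)(r-1)(d+1) + 1` points in `ℝ^d` has a
Tverberg partition into `r` parts with tolerance `t`. -/
theorem stmt_18 (d r t : ℕ) (hd : 1 ≤ d) (hr : 2 ≤ r)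
    (A : Finset (Fin d → ℝ)) (hA : (t + 1) * (r - 1) * (d + 1) + 1 ≤ A.card) :
    ∃ c : (Fin d → ℝ) → Fin r,
      ∀ C ⊆ A, C.card ≤ t →
        (⋂ i : Fin r,
          convexHull ℝ (↑((A.filter (fun x => c x = i)) \ C) : Set (Fin d → ℝ))).Nonempty := by
  classical
  obtain ⟨n, rfl⟩ : ∃ n, r = n + 2 := ⟨r - 2, by omega⟩
  have hr0 : ((n + 2 : ℕ) : ℝ) ≠ 0 := by positivity
  set R : ℝ := ((n + 2 : ℕ) : ℝ) with hR
  let G := Fin (n + 2)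
  let M := Option (Fin d)
  let hom : (Fin d → ℝ) → M → ℝ := fun a m => m.elim 1 a
  let X : A → G → EuclideanSpace ℝ (G × M) := fun a j =>
    WithLp.toLp 2 fun p => ((if p.1 = j then 1 else 0) - R⁻¹) * hom a p.2
  have hfr := finrank_ker_colourSum G M
  have hfr' : Module.finrank ℝ (LinearMap.ker (colourSum G M)) = (n + 1) * (d + 1) := by
    have hcM : Fintype.card M = d + 1 := by simp [M]
    have hcG : Fintype.card G = n + 2 := Fintype.card_fin _
    rw [hcM, hcG] at hfr
    have : (n + 2) * (d + 1) = (n + 1) * (d + 1) + (d + 1) := by ring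
    omega
  have hcol : ∀ p : G, ∑ g : G, ((if g = p then (1 : ℝ) else 0) - R⁻¹) = 0 := by
    intro p
    rw [Finset.sum_sub_distrib]
    simp only [Finset.sum_ite_eq', Finset.mem_univ, if_true, Finset.sum_const, Finset.card_univ,
      nsmul_eq_mul, G, Fintype.card_fin]
    rw [← hR, mul_inv_cancel₀ hr0, sub_self]
  have hcol' : ∀ p : G, ∑ g : G, ((if p = g then (1 : ℝ) else 0) - R⁻¹) = 0 := by
    intro p
    refine Eq.trans (Finset.sum_congr rfl fun g _ => ?_) (hcol p)
    simp only [eq_comm]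
  obtain ⟨c, hc⟩ := tolerance_key (LinearMap.ker (colourSum G M)) X
    (by
      intro a j
      rw [LinearMap.mem_ker]
      ext m
      simp only [colourSum, X, LinearMap.coe_mk, AddHom.coe_mk, Pi.zero_apply]
      rw [← Finset.sum_mul, hcol, zero_mul])
    (by
      intro a
      ext p
      simp only [X, WithLp.ofLp_sum, Finset.sum_apply, PiLp.zero_apply]
      rw [← Finset.sum_mul, hcol', zero_mul])
    (colourShift G M)
    (by
      intro g a h
      ext p
      simp only [colourShift, X, LinearMap.coe_mk, AddHom.coe_mk, sub_eq_iff_eq_add])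
    (by
      rw [hfr']
      simp only [G, Fintype.card_fin]
      nlinarith)
    (t + 1) Finset.univ
    (by
      rw [hfr', Finset.card_univ, Fintype.card_coe]
      refine le_trans (le_of_eq ?_) hA
      simp only [Nat.add_sub_cancel, show n + 2 - 1 = n + 1 from rfl]
      ring)
  refine ⟨fun x => if h : x ∈ A then c ⟨x, h⟩ else 0, fun C hCA hCt => ?_⟩
  have h0 := hc (C.subtype (· ∈ A)) (Finset.subset_univ _) (by
    rw [Finset.card_subtype]
    have := Finset.card_filter_le C (· ∈ A)
    omega)
  rw [mem_convexHull_iff_exists_fintype] at h0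
  obtain ⟨κ, _, w, z, hw, hw1, hz, hwz⟩ := h0
  choose f hfC hf using hz
  have hkey : ∀ (j : G) (m : M),
      ∑ k, (if c (f k) = j then R * w k else 0) * hom (f k) m = ∑ k, w k * hom (f k) m := by
    intro j m
    have h1 := congrArg (fun x : EuclideanSpace ℝ (G × M) => x (j, m)) hwz
    simp only [← hf, X, WithLp.ofLp_sum, Finset.sum_apply, PiLp.zero_apply, WithLp.ofLp_smul,
      Pi.smul_apply, smul_eq_mul] at h1
    have h2 : ∑ k, (if c (f k) = j then R * w k else 0) * hom (f k) m
        - ∑ k, w k * hom (f k) m =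
        R * ∑ k, w k * (((if j = c (f k) then 1 else 0) - R⁻¹) * hom (f k) m) := by
      rw [Finset.mul_sum, ← Finset.sum_sub_distrib]
      refine Finset.sum_congr rfl fun k _ => ?_
      by_cases h : c (f k) = j
      · rw [if_pos h, if_pos h.symm]
        field_simp
      · rw [if_neg h, if_neg (fun h' => h h'.symm)]
        field_simp
        ring
    rw [h1] at h2
    linarith
  refine ⟨∑ k, w k • (f k : Fin d → ℝ), Set.mem_iInter.2 fun j => ?_⟩
  have hs1 : ∑ k, (if c (f k) = j then R * w k else 0) = 1 := by
    have := hkey j none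
    simpa [hom, hw1] using this
  have hs2 : ∑ k, (if c (f k) = j then R * w k else 0) • (f k : Fin d → ℝ)
      = ∑ k, w k • (f k : Fin d → ℝ) := by
    ext m
    have := hkey j (some m)
    simpa only [hom, Finset.sum_apply, Pi.smul_apply, smul_eq_mul, Option.elim_some] using this
  rw [← hs2]
  rw [← Finset.sum_filter_of_ne (p := fun k => c (f k) = j)] at hs1 ⊢
  · refine Convex.sum_mem (convex_convexHull ℝ _) ?_ hs1 ?_
    · intro k _
      have := hw k
      split_ifs <;> positivity
    · intro k hk
      apply subset_convexHull
      have hk' := (Finset.mem_filter.1 hk).2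
      have hkC := hfC k
      simp at hkC
      simp [hk', hkC]
  · exact fun k _ h => by_contra fun h' => h (by rw [if_neg h', zero_smul])
  · exact fun k _ h => by_contra fun h' => h (if_neg h')
end
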